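/- Let (q₁, b₁, h₁) and (q₂, b₂, h₂) be potentials and let 0 < a < min(b₁, b₂). For j = 1,2, let A_j denote the A-function of the truncated potential q_j·χ_{(0,a)} (extended by 0 to (0,∞)). If A₁(α) = A₂(α) for almost every α ∈ (0,a), then q₁(x) = q₂(x) for almost every x ∈ (0,a). -/

import Mathlib

open MeasureTheory Set Filter
open scoped ENNReal

noncomputable section

/-- `Q(α) = ∫₀^α |q(y)| dy`. -/
def Qfun (q : ℝ → ℝ) (α : ℝ) : ℝ := ∫ y in Ioc (0:ℝ) α, |q y|

/-- The region `R_n(α)` for `n = k + 2`, as a subset of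
`ℝ^{2n-2} = (Fin n → ℝ) × (Fin (n-2) → ℝ)`. -/
def Rregion (k : ℕ) (α : ℝ) : Set ((Fin (k+2) → ℝ) × (Fin k → ℝ)) :=
  {p | (∀ i, 0 ≤ p.1 i) ∧
    (∀ i : Fin k,
      |p.1 (Fin.castLE (by omega) i) - p.1 (Fin.castLE (by omega) i.succ)| ≤ p.2 i ∧
      p.2 i ≤ p.1 (Fin.castLE (by omega) i) + p.1 (Fin.castLE (by omega) i.succ)) ∧
    |p.1 ⟨k, by omega⟩ - p.1 ⟨k+1, by omega⟩| ≤
        2*α - p.1 ⟨0, by omega⟩ - p.1 ⟨k+1, by omega⟩ - ∑ j, p.2 j ∧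
      2*α - p.1 ⟨0, by omega⟩ - p.1 ⟨k+1, by omega⟩ - ∑ j, p.2 j ≤
        p.1 ⟨k, by omega⟩ + p.1 ⟨k+1, by omega⟩}

/-- `A_n(α; q)`, defined for `n ≥ 2` (for `n < 2` the value is irrelevant). -/
def An (q : ℝ → ℝ) (n : ℕ) (α : ℝ) : ℝ :=
  ((-1 : ℝ)^(n-1) / 2^(n-2)) * ∫ p in Rregion (n-2) α, ∏ i, q (p.1 i)

/-- The `A`-function of `q`:  `A(α) = q(α) + ∑_{n=2}^∞ A_n(α)`. -/
def Afun (q : ℝ → ℝ) (α : ℝ) : ℝ := q α + ∑' k : ℕ, An q (k+2) α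

/-- A potential in the sense of Simon's paper: either `b < ∞`, `q ∈ L¹(0,b)` and a boundary
parameter `h ∈ ℝ ∪ {∞}` (`h = none` codes `h = ∞`, the Dirichlet condition), or `b = ∞` and
`q` is locally `L¹` with `sup_y ∫_y^{y+1} max(q,0) < ∞`. -/
structure Potential where
  b : ℝ≥0∞
  hb : 0 < b
  q : ℝ → ℝ
  h : Option ℝ
  int_fin : b ≠ ⊤ → IntegrableOn q (Ioo 0 b.toReal)
  int_inf : b = ⊤ → ∀ y : ℝ, 0 ≤ y → IntegrableOn q (Ioc y (y+1))
  sup_inf : b = ⊤ → ∃ C : ℝ, ∀ y : ℝ, 0 ≤ y → (∫ x in Ioc y (y+1), max (q x) 0) ≤ C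

/-- The closed domain `[0,b] ∩ ℝ` (i.e. `[0,∞)` if `b = ∞`). -/
def Potential.dom (P : Potential) : Set ℝ := {x | 0 ≤ x ∧ ENNReal.ofReal x ≤ P.b}

/-- The open interval `(0,b)`. -/
def Potential.ioo (P : Potential) : Set ℝ := {x | 0 < x ∧ ENNReal.ofReal x < P.b}

/-- The half-open interval `[0,b)`. -/
def Potential.ico (P : Potential) : Set ℝ := {x | 0 ≤ x ∧ ENNReal.ofReal x < P.b}

/-- `u` (with derivative `v`) is a twice-differentiable solution of `-u'' + q u = -κ² u`
on `(0,b)` with `u(0) ≠ 0` which satisfies the boundary condition at `b` (the boundary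
condition `u'(b) + h u(b) = 0`, resp. `u(b) = 0` for `h = ∞`, if `b < ∞`; square
integrability on `(0,∞)` if `b = ∞`). -/
def IsSolution (P : Potential) (κ : ℝ) (u v : ℝ → ℝ) : Prop :=
  u 0 ≠ 0 ∧
  (∀ x ∈ P.dom, HasDerivWithinAt u (v x) P.dom x) ∧
  (∀ x ∈ P.ioo, HasDerivAt v ((P.q x + κ^2) * u x) x) ∧
  (P.b = ⊤ → IntegrableOn (fun x => (u x)^2) (Ioi 0)) ∧
  (P.b ≠ ⊤ →
    P.h.elim (u P.b.toReal = 0) (fun hval => v P.b.toReal + hval * u P.b.toReal = 0))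

/-- `c` is the value `m(-κ²)` of the principal `m`-function of `P`. -/
def IsMValue (P : Potential) (κ : ℝ) (c : ℝ) : Prop :=
  ∃ u v : ℝ → ℝ, IsSolution P κ u v ∧ c = v 0 / u 0

/-- `m` represents the principal `m`-function of `P`, i.e. `m κ = m(-κ²)` for all large `κ`. -/
def IsMFun (P : Potential) (m : ℝ → ℝ) : Prop :=
  ∃ κ₀ > (0:ℝ), ∀ κ > κ₀, IsMValue P κ (m κ)

/-- If consecutive points of a path in `ℝ` are at distance at most `l i`, then twice the height of
any point is bounded by the heights of the end points plus the total length. -/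
lemma two_mul_le_of_abs_sub_le (m : ℕ) (x : Fin (m + 1) → ℝ) (l : Fin m → ℝ)
    (h : ∀ i, |x i.castSucc - x i.succ| ≤ l i) (i : Fin (m + 1)) :
    2 * x i ≤ x 0 + x (Fin.last m) + ∑ j, l j := by
  induction m with
  | zero =>
    have hi : i = 0 := Fin.fin_one_eq_zero i
    subst hi
    have : Fin.last 0 = 0 := rfl
    simp only [this, Finset.univ_eq_empty, Finset.sum_empty]
    linarith
  | succ m ih =>
    have ih' := ih (fun j => x j.castSucc) (fun j => l j.castSucc) (fun j => h j.castSucc)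
    have hlast := abs_le.1 (h (Fin.last m))
    rw [Fin.succ_last] at hlast
    rw [Fin.sum_univ_castSucc]
    induction i using Fin.lastCases with
    | last =>
      have := ih' (Fin.last m)
      simp only [Fin.castSucc_zero] at this
      linarith
    | cast i =>
      have := ih' i
      simp only [Fin.castSucc_zero] at this
      linarith

lemma Rregion_subset {k : ℕ} {α : ℝ} {p : (Fin (k + 2) → ℝ) × (Fin k → ℝ)}
    (hp : p ∈ Rregion k α) :
    (∀ i, p.1 i ∈ Icc 0 α) ∧ (∀ i, 0 ≤ p.2 i) ∧ ∑ j, p.2 j ≤ 2 * α := by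
  obtain ⟨h0, h1, h2, -⟩ := hp
  refine ⟨fun i => ⟨h0 i, ?_⟩, fun i => (abs_nonneg _).trans (h1 i).1, ?_⟩
  · have := two_mul_le_of_abs_sub_le (k + 1) p.1
      (Fin.snoc p.2
        (2 * α - p.1 ⟨0, by omega⟩ - p.1 ⟨k + 1, by omega⟩ - ∑ j, p.2 j) : Fin (k + 1) → ℝ) ?_ i
    · rw [Fin.sum_univ_castSucc] at this
      simp only [Fin.snoc_castSucc, Fin.snoc_last] at this
      have e0 : p.1 ⟨0, by omega⟩ = p.1 0 := rfl
      have e1 : p.1 ⟨k + 1, by omega⟩ = p.1 (Fin.last (k + 1)) := rfl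
      rw [e0, e1] at this
      linarith
    · intro j
      induction j using Fin.lastCases with
      | last => rw [Fin.snoc_last]; exact h2
      | cast j => rw [Fin.snoc_castSucc]; exact (h1 j).1
  · have := (abs_nonneg _).trans h2
    have := h0 ⟨0, by omega⟩
    have := h0 ⟨k + 1, by omega⟩
    linarith

lemma measurableSet_Rregion (k : ℕ) (α : ℝ) : MeasurableSet (Rregion k α) := by
  unfold Rregion
  simp only [ofPred_and, ofPred_forall]
  measurability

/-- A telescoping bound for the difference of two products. -/
lemma abs_prod_sub_prod_le {ι : Type*} [DecidableEq ι] (s : Finset ι) (a b : ι → ℝ) :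
    |∏ i ∈ s, a i - ∏ i ∈ s, b i| ≤
      ∑ i ∈ s, ∏ j ∈ s, if j = i then |a j - b j| else |a j| + |b j| := by
  induction s using Finset.induction_on with
  | empty => simp
  | insert i₀ s hi ih =>
    rw [Finset.prod_insert hi, Finset.prod_insert hi, Finset.sum_insert hi,
      Finset.prod_insert hi, if_pos rfl]
    have h1 : ∏ j ∈ s, (if j = i₀ then |a j - b j| else |a j| + |b j|) =
        ∏ j ∈ s, (|a j| + |b j|) :=
      Finset.prod_congr rfl fun j hj => if_neg (by rintro rfl; exact hi hj)
    have h2 : ∑ i ∈ s, ∏ j ∈ insert i₀ s, (if j = i then |a j - b j| else |a j| + |b j|) =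
        (|a i₀| + |b i₀|) *
          ∑ i ∈ s, ∏ j ∈ s, if j = i then |a j - b j| else |a j| + |b j| := by
      rw [Finset.mul_sum]
      refine Finset.sum_congr rfl fun i his => ?_
      rw [Finset.prod_insert hi, if_neg (by rintro rfl; exact hi his)]
    rw [h1, h2]
    have h3 : |∏ j ∈ s, a j| ≤ ∏ j ∈ s, (|a j| + |b j|) := by
      rw [Finset.abs_prod]
      exact Finset.prod_le_prod (fun _ _ => abs_nonneg _)
        fun j _ => le_add_of_nonneg_right (abs_nonneg _)
    calc |a i₀ * ∏ j ∈ s, a j - b i₀ * ∏ j ∈ s, b j|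
        = |(a i₀ - b i₀) * ∏ j ∈ s, a j + b i₀ * (∏ j ∈ s, a j - ∏ j ∈ s, b j)| := by
          congr 1; ring
      _ ≤ |a i₀ - b i₀| * |∏ j ∈ s, a j| + |b i₀| * |∏ j ∈ s, a j - ∏ j ∈ s, b j| := by
          rw [← abs_mul, ← abs_mul]; exact abs_add_le _ _
      _ ≤ _ := by
          gcongr
          exact le_add_of_nonneg_left (abs_nonneg _)

/-- The exponential density `exp (-t x)` on `[0, ∞)`. -/
def expWeight (t : ℝ) : ℝ → ℝ := (Ici (0:ℝ)).indicator fun x => Real.exp (-t * x)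

lemma integrable_expWeight {t : ℝ} (ht : 0 < t) : Integrable (expWeight t) := by
  rw [expWeight, integrable_indicator_iff measurableSet_Ici, integrableOn_Ici_iff_integrableOn_Ioi]
  exact exp_neg_integrableOn_Ioi 0 ht

lemma integral_expWeight {t : ℝ} (ht : 0 < t) : ∫ x, expWeight t x = t⁻¹ := by
  rw [expWeight, integral_indicator measurableSet_Ici, integral_Ici_eq_integral_Ioi,
    integral_exp_mul_Ioi (by linarith)]
  simp [neg_div, div_neg]

lemma one_le_exp_mul_prod_expWeight {k : ℕ} {α t : ℝ} (ht : 0 < t)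
    {p : (Fin (k + 2) → ℝ) × (Fin k → ℝ)} (hp : p ∈ Rregion k α) :
    1 ≤ Real.exp (2 * α * t) * ∏ j, expWeight t (p.2 j) := by
  obtain ⟨-, h1, h2⟩ := Rregion_subset hp
  have : ∏ j, expWeight t (p.2 j) = Real.exp (-t * ∑ j, p.2 j) := by
    rw [Finset.mul_sum, Real.exp_sum]
    exact Finset.prod_congr rfl fun j _ => indicator_of_mem (mem_Ici.2 (h1 j)) _
  rw [this, ← Real.exp_add, Real.one_le_exp_iff]
  nlinarith

lemma integrableOn_Rregion_prod {f : ℝ → ℝ} (hf : Integrable f) (k : ℕ) (α : ℝ) :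
    IntegrableOn (fun p : (Fin (k + 2) → ℝ) × (Fin k → ℝ) => ∏ i, f (p.1 i)) (Rregion k α) := by
  have hF : Integrable (fun x : Fin (k + 2) → ℝ => ∏ i, f (x i)) :=
    Integrable.fintype_prod (f := fun _ => f) fun _ => hf
  have hE : Integrable (fun l : Fin k → ℝ => Real.exp (2 * α * 1) * ∏ j, expWeight 1 (l j)) :=
    (Integrable.fintype_prod (f := fun _ => expWeight 1)
      fun _ => integrable_expWeight one_pos).const_mul _
  refine Integrable.mono (hF.mul_prod hE).integrableOn
    hF.aestronglyMeasurable.comp_fst.restrict ?_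
  refine (ae_restrict_iff' (measurableSet_Rregion k α)).2 (Eventually.of_forall fun p hp => ?_)
  rw [norm_mul]
  exact le_mul_of_one_le_right (norm_nonneg _)
    ((one_le_exp_mul_prod_expWeight one_pos hp).trans (Real.le_norm_self _))

lemma abs_An_sub_An_le {f g : ℝ → ℝ} (hf : Integrable f) (hg : Integrable g) (k : ℕ) {α t : ℝ}
    (ht : 0 < t) :
    |An f (k + 2) α - An g (k + 2) α| ≤
      Real.exp (2 * α * t) * (∫ x in Icc 0 α, |f x - g x|) *
        ((k + 2) * (∫ x, |f x| + |g x|) ^ (k + 1) * ((2 * t)⁻¹) ^ k) := by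
  set w : Fin (k + 2) → Fin (k + 2) → ℝ → ℝ := fun i j =>
    if j = i then (Icc 0 α).indicator (fun x => |f x - g x|) else fun x => |f x| + |g x| with hw
  have hwi : ∀ i j, Integrable (w i j) := by
    intro i j
    simp only [hw]
    split_ifs
    · exact (hf.sub hg).abs.indicator measurableSet_Icc
    · exact hf.abs.add hg.abs
  have hF : Integrable (fun x : Fin (k + 2) → ℝ => ∑ i, ∏ j, w i j (x j)) :=
    integrable_finsetSum _ fun i _ => Integrable.fintype_prod (hwi i)
  have hE : Integrable (fun l : Fin k → ℝ => Real.exp (2 * α * t) * ∏ j, expWeight t (l j)) :=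
    (Integrable.fintype_prod (f := fun _ => expWeight t)
      fun _ => integrable_expWeight ht).const_mul _
  have hw0 : ∀ i j x, 0 ≤ w i j x := by
    intro i j x
    simp only [hw]
    split_ifs
    · exact indicator_nonneg (fun _ _ => abs_nonneg _) _
    · positivity
  have hE0 : ∀ x, 0 ≤ expWeight t x := fun x =>
    indicator_nonneg (fun _ _ => (Real.exp_pos _).le) _
  have hint : Integrable (fun z : (Fin (k + 2) → ℝ) × (Fin k → ℝ) =>
      (∑ i, ∏ j, w i j (z.1 j)) * (Real.exp (2 * α * t) * ∏ j, expWeight t (z.2 j))) :=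
    hF.mul_prod hE
  have hIF : ∫ x : Fin (k + 2) → ℝ, ∑ i, ∏ j, w i j (x j) =
      (k + 2) * ((∫ x in Icc 0 α, |f x - g x|) * (∫ x, |f x| + |g x|) ^ (k + 1)) := by
    have hprod : ∀ i, Integrable (fun x : Fin (k + 2) → ℝ => ∏ j, w i j (x j)) :=
      fun i => Integrable.fintype_prod (hwi i)
    rw [integral_finsetSum _ fun i _ => hprod i]
    have : ∀ i, ∫ x : Fin (k + 2) → ℝ, ∏ j, w i j (x j) =
        (∫ x in Icc 0 α, |f x - g x|) * (∫ x, |f x| + |g x|) ^ (k + 1) := by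
      intro i
      rw [integral_fintype_prod_volume_eq_prod (w i),
        ← Finset.mul_prod_erase _ _ (Finset.mem_univ i)]
      congr 1
      · simp only [hw, if_true]
        exact integral_indicator measurableSet_Icc
      · rw [Finset.prod_congr rfl (g := fun _ => ∫ x, |f x| + |g x|), Finset.prod_const,
          Finset.card_erase_of_mem (Finset.mem_univ i)]
        · simp
        · intro j hj
          simp only [hw, if_neg (Finset.ne_of_mem_erase hj)]
    simp [this]
  have hIE : ∫ l : Fin k → ℝ, Real.exp (2 * α * t) * ∏ j, expWeight t (l j) =
      Real.exp (2 * α * t) * (t⁻¹) ^ k := by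
    rw [integral_const_mul, integral_fintype_prod_volume_eq_prod (fun _ => expWeight t)]
    simp [integral_expWeight ht]
  have key : |∫ p in Rregion k α, (∏ i, f (p.1 i) - ∏ i, g (p.1 i))| ≤
      (k + 2) * ((∫ x in Icc 0 α, |f x - g x|) * (∫ x, |f x| + |g x|) ^ (k + 1)) *
        (Real.exp (2 * α * t) * (t⁻¹) ^ k) := by
    rw [← hIF, ← hIE, ← integral_prod_mul, ← Measure.volume_eq_prod,
      ← Real.norm_eq_abs]
    refine (norm_integral_le_of_norm_le (hint.integrableOn (s := Rregion k α)) ?_).trans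
      (setIntegral_le_integral hint (Eventually.of_forall fun p => ?_))
    · refine (ae_restrict_iff' (measurableSet_Rregion k α)).2
        (Eventually.of_forall fun p hp => ?_)
      refine (abs_prod_sub_prod_le Finset.univ _ _).trans ?_
      have : ∀ i j, (if j = i then |f (p.1 j) - g (p.1 j)| else |f (p.1 j)| + |g (p.1 j)|) =
          w i j (p.1 j) := by
        intro i j
        simp only [hw]
        split_ifs
        · rw [indicator_of_mem ((Rregion_subset hp).1 j)]
        · rfl
      simp only [this]
      exact le_mul_of_one_le_right
        (Finset.sum_nonneg fun i _ => Finset.prod_nonneg fun j _ => hw0 i j _)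
        (one_le_exp_mul_prod_expWeight ht hp)
    · refine mul_nonneg (Finset.sum_nonneg fun i _ => ?_) ?_
      · exact Finset.prod_nonneg fun j _ => hw0 i j _
      · exact mul_nonneg (Real.exp_pos _).le (Finset.prod_nonneg fun j _ => hE0 _)
  have hsub : An f (k + 2) α - An g (k + 2) α =
      ((-1 : ℝ) ^ (k + 1) / 2 ^ k) *
        ∫ p in Rregion k α, (∏ i, f (p.1 i) - ∏ i, g (p.1 i)) := by
    rw [integral_sub (integrableOn_Rregion_prod hf k α) (integrableOn_Rregion_prod hg k α),
      mul_sub]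
    rfl
  rw [hsub, abs_mul, abs_div, abs_pow, abs_neg, abs_one, one_pow, abs_of_pos (by positivity)]
  refine (mul_le_mul_of_nonneg_left key (by positivity)).trans (le_of_eq ?_)
  rw [mul_inv, mul_pow, inv_pow 2]
  ring

lemma An_zero (k : ℕ) (α : ℝ) : An 0 (k + 2) α = 0 := by
  simp [An]

lemma summable_bound {M t : ℝ} (hM : 0 ≤ M) (ht : M < t) :
    Summable fun k : ℕ => ((k : ℝ) + 2) * M ^ (k + 1) * ((2 * t)⁻¹) ^ k := by
  have ht0 : 0 < t := hM.trans_lt ht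
  have hr : ‖M * (2 * t)⁻¹‖ < 1 := by
    rw [Real.norm_of_nonneg (by positivity), ← div_eq_mul_inv, div_lt_one (by positivity)]
    linarith
  have h1 := summable_pow_mul_geometric_of_norm_lt_one 1 hr
  have h0 := (summable_geometric_of_norm_lt_one hr).mul_left 2
  refine ((h1.add h0).mul_left M).congr fun k => ?_
  rw [mul_pow]
  ring

lemma summable_An {f : ℝ → ℝ} (hf : Integrable f) (α : ℝ) :
    Summable fun k : ℕ => An f (k + 2) α := by
  set M := ∫ x, |f x| + |(0:ℝ)|
  have hM : 0 ≤ M := integral_nonneg fun x => by positivity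
  refine Summable.of_norm_bounded
    ((summable_bound hM (lt_add_one M)).mul_left (Real.exp (2 * α * (M + 1)) *
      (∫ x in Icc 0 α, |f x - 0|))) fun k => ?_
  have := abs_An_sub_An_le hf (integrable_zero ℝ ℝ volume) k (α := α)
    (t := M + 1) (by linarith)
  rwa [An_zero, sub_zero] at this

/-- The difference of two potentials is controlled by its own integral wherever the `A`-functions
agree. -/
lemma exists_abs_sub_le_of_Afun_eq {f g : ℝ → ℝ} (hf : Integrable f) (hg : Integrable g) (a : ℝ) :
    ∃ C : ℝ, 0 ≤ C ∧ ∀ α ≤ a, Afun f α = Afun g α →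
      |f α - g α| ≤ C * ∫ x in Icc 0 α, |f x - g x| := by
  set M := ∫ x, |f x| + |g x|
  have hM : 0 ≤ M := integral_nonneg fun x => by positivity
  have hs := summable_bound hM (lt_add_one M)
  set S := ∑' k : ℕ, ((k : ℝ) + 2) * M ^ (k + 1) * ((2 * (M + 1))⁻¹) ^ k
  have hS0 : 0 ≤ S := tsum_nonneg fun k => by positivity
  refine ⟨Real.exp (2 * a * (M + 1)) * S, by positivity, fun α hα h => ?_⟩
  have hI : 0 ≤ ∫ x in Icc 0 α, |f x - g x| := integral_nonneg fun x => abs_nonneg _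
  have h1 : f α - g α = -∑' k : ℕ, (An f (k + 2) α - An g (k + 2) α) := by
    rw [(summable_An hf α).tsum_sub (summable_An hg α)]
    simp only [Afun] at h
    linarith
  rw [h1, abs_neg]
  rw [← Real.norm_eq_abs]
  have hb := fun k => abs_An_sub_An_le hf hg k (α := α) (t := M + 1) (by linarith)
  refine (tsum_of_norm_bounded (hs.hasSum.mul_left (Real.exp (2 * α * (M + 1)) *
    (∫ x in Icc 0 α, |f x - g x|))) hb).trans ?_
  have : Real.exp (2 * α * (M + 1)) ≤ Real.exp (2 * a * (M + 1)) := by gcongr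
  calc _ ≤ Real.exp (2 * a * (M + 1)) * (∫ x in Icc 0 α, |f x - g x|) * S := by gcongr
    _ = _ := by ring

/-- A Grönwall lemma for integrable functions bounded by a multiple of their own primitive. -/
lemma ae_eq_zero_of_le_mul_integral {u : ℝ → ℝ} (hu : Integrable u) (hu0 : ∀ x, 0 ≤ u x) {a C : ℝ}
    (ha : 0 < a) (h : ∀ᵐ x ∂(volume.restrict (Ioo (0:ℝ) a)), u x ≤ C * ∫ y in Icc 0 x, u y) :
    ∀ᵐ x ∂(volume.restrict (Ioo (0:ℝ) a)), u x = 0 := by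
  set D : ℝ → ℝ := fun x => ∫ y in (0:ℝ)..x, u y with hD
  have hDc : Continuous D :=
    intervalIntegral.continuous_primitive (fun _ _ => hu.intervalIntegrable) 0
  have hDI : ∀ x, 0 ≤ x → ∫ y in Icc 0 x, u y = D x := fun x hx => by
    rw [hD, integral_Icc_eq_integral_Ioc, ← intervalIntegral.integral_of_le hx]
  have hD0 : ∀ x, 0 ≤ x → 0 ≤ D x := fun x hx =>
    intervalIntegral.integral_nonneg hx fun y _ => hu0 y
  set F : ℝ → ℝ := fun x => ∫ y in (0:ℝ)..x, D y with hF
  have hF0 : ∀ x, 0 ≤ x → 0 ≤ F x := fun x hx =>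
    intervalIntegral.integral_nonneg hx fun y hy => hD0 y hy.1
  have hFd : ∀ x, HasDerivAt F (D x) x := fun x => hDc.integral_hasStrictDerivAt 0 x |>.hasDerivAt
  have h' : ∀ᵐ x, x ∈ Ioo 0 a → u x ≤ C * D x := by
    filter_upwards [(ae_restrict_iff' measurableSet_Ioo).1 h] with x hx hxa
    rw [← hDI x hxa.1.le]
    exact hx hxa
  have hDF : ∀ x ∈ Icc 0 a, D x ≤ C * F x := by
    intro x hx
    rw [hF, ← intervalIntegral.integral_const_mul]
    simp only [hD]
    rw [intervalIntegral.integral_of_le hx.1, intervalIntegral.integral_of_le hx.1,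
      integral_Ioc_eq_integral_Ioo, integral_Ioc_eq_integral_Ioo]
    refine setIntegral_mono_ae_restrict hu.integrableOn
      ((hDc.const_mul C).integrableOn_Icc.mono_set Ioo_subset_Icc_self) ?_
    refine (ae_restrict_iff' measurableSet_Ioo).2 ?_
    filter_upwards [h'] with y hy hyx
    exact hy ⟨hyx.1, hyx.2.trans_le hx.2⟩
  have hFz : ∀ x ∈ Icc 0 a, F x = 0 := by
    refine eq_zero_of_abs_deriv_le_mul_abs_self_of_eq_zero_right (K := C) (f' := D)
      (fun x _ => (hFd x).continuousAt.continuousWithinAt)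
      (fun x _ => (hFd x).hasDerivWithinAt) (by simp [hF]) fun x hx => ?_
    rw [Real.norm_of_nonneg (hD0 x hx.1), Real.norm_of_nonneg (hF0 x hx.1)]
    exact hDF x (Ico_subset_Icc_self hx)
  have hDa : ∫ y in Icc 0 a, u y = 0 := by
    rw [hDI a ha.le]
    have := hDF a (right_mem_Icc.2 ha.le)
    rw [hFz a (right_mem_Icc.2 ha.le), mul_zero] at this
    exact le_antisymm this (hD0 a ha.le)
  have := (integral_eq_zero_iff_of_nonneg hu0 hu.integrableOn).1 hDa
  exact ae_restrict_of_ae_restrict_of_subset Ioo_subset_Icc_self this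

lemma Potential.integrableOn_Ioo (P : Potential) {a : ℝ} (ha : ENNReal.ofReal a < P.b) :
    IntegrableOn P.q (Ioo 0 a) := by
  by_cases hb : P.b = ⊤
  · have : ∀ n : ℕ, IntegrableOn P.q (Ioc 0 (n : ℝ)) := by
      intro n
      induction n with
      | zero => simp
      | succ n ih =>
        push_cast
        rw [← Ioc_union_Ioc_eq_Ioc (Nat.cast_nonneg n) (by linarith : (n : ℝ) ≤ n + 1)]
        exact ih.union (P.int_inf hb n (Nat.cast_nonneg n))
    obtain ⟨n, hn⟩ := exists_nat_ge a
    exact (this n).mono_set fun x hx => ⟨hx.1, hx.2.le.trans hn⟩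
  · refine (P.int_fin hb).mono_set (Ioo_subset_Ioo_right ?_)
    exact (ENNReal.ofReal_le_iff_le_toReal hb).1 ha.le

lemma Potential.integrable_truncation (P : Potential) {a : ℝ} (ha : ENNReal.ofReal a < P.b) :
    Integrable fun x => if x ∈ Ioo (0:ℝ) a then P.q x else 0 :=
  ((P.integrableOn_Ioo ha).integrable_indicator measurableSet_Ioo).congr
    (Eventually.of_forall fun x => by simp [indicator])

/-- Theorem 1.5 / 7.1:  `q` on `[0,a]` is determined by `A` on `[0,a]`:  if the `A`-functions
of the truncated potentials `qⱼ·χ_{(0,a)}` agree a.e. on `(0,a)`, then `q₁ = q₂` a.e. on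
`(0,a)`. -/
theorem uniqueness_theorem (P₁ P₂ : Potential) (a : ℝ) (ha : 0 < a)
    (ha₁ : ENNReal.ofReal a < P₁.b) (ha₂ : ENNReal.ofReal a < P₂.b)
    (hA : ∀ᵐ α ∂(volume.restrict (Ioo (0:ℝ) a)),
      Afun (fun x => if x ∈ Ioo (0:ℝ) a then P₁.q x else 0) α =
        Afun (fun x => if x ∈ Ioo (0:ℝ) a then P₂.q x else 0) α) :
    ∀ᵐ x ∂(volume.restrict (Ioo (0:ℝ) a)), P₁.q x = P₂.q x := by
  have hf := P₁.integrable_truncation ha₁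
  have hg := P₂.integrable_truncation ha₂
  obtain ⟨C, -, hC⟩ := exists_abs_sub_le_of_Afun_eq hf hg a
  have hz := ae_eq_zero_of_le_mul_integral (hf.sub hg).abs (fun _ => abs_nonneg _) ha (C := C) (by
    filter_upwards [hA, ae_restrict_mem measurableSet_Ioo] with α hα hmem
    exact hC α hmem.2.le hα)
  filter_upwards [hz, ae_restrict_mem measurableSet_Ioo] with x hx hmem
  simp only [Pi.sub_apply, if_pos hmem, abs_eq_zero, sub_eq_zero] at hx
  exact hx

end
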